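/- Let n ≥ 1 be an integer. For every real t in (−1,1), the series Φ̃_n(t) = Σ_{k=0}^{∞} α_k^{(n)}·Q_k(t) converges, and for every j = 1, …, n the quadrature weight satisfies W_j = −2·Φ̃_n(t_j)/ψ_n'(t_j). -/

import Mathlib

open Real MeasureTheory Set

/-- A `k`-th prolate datum for band limit `c`: `ψ` is real-analytic with unit
`L²[-1,1]` norm, has exactly `k` zeros in `(-1,1)`, is an eigenfunction of the
prolate integral operator with nonzero eigenvalue `lam`, and satisfies the
prolate differential equation with eigenvalue `χ`. -/
structure ProlateDatum (c : ℝ) (k : ℕ) (ψ : ℝ → ℝ) (lam : ℂ) (χ : ℝ) : Prop where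
  analytic : ∀ x : ℝ, AnalyticAt ℝ ψ x
  normalized : ∫ t in (-1:ℝ)..1, (ψ t)^2 = 1
  zeros_card : {x : ℝ | x ∈ Set.Ioo (-1:ℝ) 1 ∧ ψ x = 0}.encard = k
  lam_ne_zero : lam ≠ 0
  integral_eig : ∀ x : ℝ,
    lam * (ψ x : ℂ) =
      ∫ t in (-1:ℝ)..1, (ψ t : ℂ) * Complex.exp (Complex.I * (c:ℂ) * (x:ℂ) * (t:ℂ))
  diff_eq : ∀ x : ℝ,
    (1 - x^2) * deriv (deriv ψ) x - 2*x * deriv ψ x + (χ - c^2 * x^2) * ψ x = 0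

/-- The `j`-th weight of the PSWF-based quadrature rule:
`W_j = (1/ψₙ'(t_j)) ∫_{-1}^1 ψₙ(s)/(s - t_j) ds`. -/
noncomputable def quadWeight (ψn : ℝ → ℝ) (tj : ℝ) : ℝ :=
  (1 / deriv ψn tj) * ∫ s in (-1:ℝ)..1, ψn s / (s - tj)

/-- The Legendre polynomials, via `P₀ = 1`, `P₁ = t`, and
`(k+1)·P_{k+1}(t) = (2k+1)·t·P_k(t) − k·P_{k−1}(t)`. -/
noncomputable def legendreP : ℕ → ℝ → ℝ
  | 0, _ => 1
  | 1, t => t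
  | (k+2), t => ((2*(k:ℝ)+3) * t * legendreP (k+1) t - ((k:ℝ)+1) * legendreP k t) / ((k:ℝ)+2)

/-- The Legendre functions of the second kind on `(-1,1)`, via
`Q₀(t) = (1/2)·log((1+t)/(1−t))`, `Q₁(t) = (t/2)·log((1+t)/(1−t)) − 1`, and
`(k+1)·Q_{k+1}(t) = (2k+1)·t·Q_k(t) − k·Q_{k−1}(t)`. -/
noncomputable def legendreQ : ℕ → ℝ → ℝ
  | 0, t => (1/2) * Real.log ((1+t)/(1-t))
  | 1, t => (t/2) * Real.log ((1+t)/(1-t)) - 1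
  | (k+2), t => ((2*(k:ℝ)+3) * t * legendreQ (k+1) t - ((k:ℝ)+1) * legendreQ k t) / ((k:ℝ)+2)

/-- The `k`-th Legendre coefficient `α_k = (k + 1/2)·∫_{-1}^1 ψ(x)·P_k(x) dx`. -/
noncomputable def legendreCoeff (ψ : ℝ → ℝ) (k : ℕ) : ℝ :=
  ((k:ℝ) + 1/2) * ∫ x in (-1:ℝ)..1, ψ x * legendreP k x


lemma _root_.HasSum.congr_pt {E : Type*} [AddCommMonoid E] [TopologicalSpace E] {f g : ℕ → E}
    {a : E} (h : HasSum f a) (hfg : ∀ j, g j = f j) : HasSum g a := by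
  rwa [show g = f from funext hfg]

lemma legP_rec (k : ℕ) (x : ℝ) : ((k:ℝ)+2) * legendreP (k+2) x
    = (2*(k:ℝ)+3) * x * legendreP (k+1) x - ((k:ℝ)+1) * legendreP k x := by
  have h : ((k:ℝ)+2) ≠ 0 := by positivity
  rw [legendreP]; field_simp

lemma legQ_rec (k : ℕ) (x : ℝ) : ((k:ℝ)+2) * legendreQ (k+2) x
    = (2*(k:ℝ)+3) * x * legendreQ (k+1) x - ((k:ℝ)+1) * legendreQ k x := by
  have h : ((k:ℝ)+2) ≠ 0 := by positivity
  rw [legendreQ]; field_simp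

/-- Derivatives of the Legendre polynomials. -/
noncomputable def legendreD : ℕ → ℝ → ℝ
  | 0, _ => 0
  | (k+1), t => t * legendreD k t + ((k:ℝ)+1) * legendreP k t

lemma legD_B (k : ℕ) (x : ℝ) :
    x * legendreD (k+1) x = legendreD k x + ((k:ℝ)+1) * legendreP (k+1) x := by
  induction k with
  | zero => simp [legendreD, legendreP]
  | succ k ih =>
    have h1 : legendreD (k+2) x = x * legendreD (k+1) x + ((k:ℝ)+2) * legendreP (k+1) x := by
      rw [legendreD]; push_cast; ring
    have h2 : legendreD (k+1) x = x * legendreD k x + ((k:ℝ)+1) * legendreP k x := by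
      rw [legendreD]
    have h3 := legP_rec k x
    rw [h1]
    push_cast
    have h4 : ((k:ℝ)+1+1) * legendreP (k+1+1) x = ((k:ℝ)+2) * legendreP (k+2) x := by
      ring_nf
    rw [h4, h3]
    linear_combination x * ih - h2

lemma legP_deriv (k : ℕ) (x : ℝ) : HasDerivAt (legendreP k) (legendreD k x) x ∧
    HasDerivAt (legendreP (k+1)) (legendreD (k+1) x) x := by
  induction k with
  | zero =>
    constructor
    · have : legendreP 0 = fun _ => 1 := by funext y; rw [legendreP]
      rw [this]; simpa [legendreD] using hasDerivAt_const x (1:ℝ)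
    · have : legendreP (0+1) = fun y => y := by funext y; rw [legendreP]
      rw [this]; simpa [legendreD, legendreP] using hasDerivAt_id' x
  | succ k ih =>
    refine ⟨ih.2, ?_⟩
    have hf : legendreP (k+1+1) = fun y => ((2*(k:ℝ)+3) * y * legendreP (k+1) y
        - ((k:ℝ)+1) * legendreP k y) / ((k:ℝ)+2) := by funext y; rw [legendreP]
    rw [hf]
    have h := ((((hasDerivAt_id' x).const_mul (2*(k:ℝ)+3)).mul ih.2).sub
      (ih.1.const_mul ((k:ℝ)+1))).div_const ((k:ℝ)+2)
    refine h.congr_deriv ?_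
    have h0 : ((k:ℝ)+2) ≠ 0 := by positivity
    have hB := legD_B k x
    have h1 : legendreD (k+1+1) x = x * legendreD (k+1) x + ((k:ℝ)+2) * legendreP (k+1) x := by
      rw [legendreD]; push_cast; ring
    rw [h1, div_eq_iff h0]
    linear_combination ((k:ℝ)+1) * hB

lemma legP_cont (k : ℕ) : Continuous (legendreP k) :=
  continuous_iff_continuousAt.2 fun x => (legP_deriv k x).1.continuousAt

lemma legP_one (k : ℕ) : legendreP k 1 = 1 ∧ legendreP (k+1) 1 = 1 := by
  induction k with
  | zero => simp [legendreP]
  | succ k ih =>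
    refine ⟨ih.2, ?_⟩
    have h0 : ((k:ℝ)+2) ≠ 0 := by positivity
    have h := legP_rec k 1
    rw [ih.1, ih.2] at h
    apply mul_left_cancel₀ h0
    rw [show k+1+1 = k+2 from rfl, h]; ring

lemma legP_neg_one (k : ℕ) : legendreP k (-1) = (-1)^k ∧ legendreP (k+1) (-1) = (-1)^(k+1) := by
  induction k with
  | zero => simp [legendreP]
  | succ k ih =>
    refine ⟨ih.2, ?_⟩
    have h0 : ((k:ℝ)+2) ≠ 0 := by positivity
    have h := legP_rec k (-1)
    rw [ih.1, ih.2] at h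
    apply mul_left_cancel₀ h0
    rw [show k+1+1 = k+2 from rfl, h]; ring

lemma legP_int (k : ℕ) : ∫ x in (-1:ℝ)..1, legendreP (k+1) x = 0 := by
  have hd : ∀ x ∈ Set.uIcc (-1:ℝ) 1, HasDerivAt
      (fun y => (legendreP (k+2) y - legendreP k y) / (2*(k:ℝ)+3)) (legendreP (k+1) x) x := by
    intro x _
    have h := ((legP_deriv (k+1) x).2.sub (legP_deriv k x).1).div_const (2*(k:ℝ)+3)
    refine h.congr_deriv ?_
    have h0 : (2*(k:ℝ)+3) ≠ 0 := by positivity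
    have hB := legD_B k x
    have h1 : legendreD (k+1+1) x = x * legendreD (k+1) x + ((k:ℝ)+2) * legendreP (k+1) x := by
      rw [legendreD]; push_cast; ring
    rw [h1, div_eq_iff h0]
    linear_combination hB
  rw [intervalIntegral.integral_eq_sub_of_hasDerivAt hd ((legP_cont _).intervalIntegrable _ _)]
  rw [(legP_one (k+2)).1, (legP_one k).1, (legP_neg_one (k+2)).1, (legP_neg_one k).1]
  ring

/-- moments -/
noncomputable def legB (j k : ℕ) : ℝ := ∫ x in (-1:ℝ)..1, x^j * legendreP k x

lemma legB_zero (j : ℕ) : legB (j+1) 0 = legB j 1 := by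
  unfold legB
  congr 1; funext x; simp only [legendreP]; ring

lemma legB_succ (j k : ℕ) : (2*(k:ℝ)+3) * legB (j+1) (k+1)
    = ((k:ℝ)+2) * legB j (k+2) + ((k:ℝ)+1) * legB j k := by
  unfold legB
  rw [← intervalIntegral.integral_const_mul, ← intervalIntegral.integral_const_mul,
    ← intervalIntegral.integral_const_mul, ← intervalIntegral.integral_add]
  · congr 1; funext x
    linear_combination (-x^j) * legP_rec k x
  · have := legP_cont (k+2)
    exact Continuous.intervalIntegrable (by fun_prop) _ _
  · have := legP_cont k
    exact Continuous.intervalIntegrable (by fun_prop) _ _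

lemma legB_vanish (j k : ℕ) (h : j < k) : legB j k = 0 := by
  induction j generalizing k with
  | zero =>
    obtain ⟨m, rfl⟩ : ∃ m, k = m+1 := ⟨k-1, by omega⟩
    unfold legB; simpa using legP_int m
  | succ j ih =>
    obtain ⟨m, rfl⟩ : ∃ m, k = m+1 := ⟨k-1, by omega⟩
    have h0 : (2*(m:ℝ)+3) ≠ 0 := by positivity
    have := legB_succ j m
    rw [ih _ (by omega), ih _ (by omega)] at this
    apply mul_left_cancel₀ h0
    rw [this]; ring

lemma legP_bound (x : ℝ) (hx : |x| ≤ 1) (k : ℕ) :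
    |legendreP k x| ≤ 3^k ∧ |legendreP (k+1) x| ≤ 3^(k+1) := by
  induction k with
  | zero => simp [legendreP]; linarith
  | succ k ih =>
    refine ⟨ih.2, ?_⟩
    have h0 : 0 < ((k:ℝ)+2) := by positivity
    have h := legP_rec k x
    have hx1 : |x * legendreP (k+1) x| ≤ 3^(k+1) := by
      rw [abs_mul]
      calc _ ≤ 1 * |legendreP (k+1) x| := by gcongr
        _ ≤ _ := by rw [one_mul]; exact ih.2
    have h3 := ih.1
    rw [abs_le] at hx1 h3
    have hk : (0:ℝ) ≤ k := by positivity
    have h9 : (0:ℝ) < 3^k := by positivity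
    have e1 : (3:ℝ)^(k+1) = 3 * 3^k := by ring
    have e2 : (3:ℝ)^(k+1+1) = 9 * 3^k := by ring
    rw [e1] at hx1
    rw [e2, abs_le]
    have h' : legendreP (k+1+1) x = legendreP (k+2) x := rfl
    rw [h']
    have hk9 : 0 ≤ (k:ℝ) * 3^k := by positivity
    constructor
    · refine le_of_mul_le_mul_left ?_ h0
      rw [h]
      nlinarith [mul_le_mul_of_nonneg_left hx1.1 (by positivity : 0 ≤ 2*(k:ℝ)+3),
        mul_le_mul_of_nonneg_left h3.2 (by positivity : 0 ≤ (k:ℝ)+1)]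
    · refine le_of_mul_le_mul_left ?_ h0
      rw [h]
      nlinarith [mul_le_mul_of_nonneg_left hx1.2 (by positivity : 0 ≤ 2*(k:ℝ)+3),
        mul_le_mul_of_nonneg_left h3.1 (by positivity : 0 ≤ (k:ℝ)+1)]

lemma legQ_bound (x : ℝ) (hx : |x| ≤ 1) (M : ℝ) (h0M : |legendreQ 0 x| ≤ M)
    (h1M : |legendreQ 1 x| ≤ M) (k : ℕ) :
    |legendreQ k x| ≤ M * 3^k ∧ |legendreQ (k+1) x| ≤ M * 3^(k+1) := by
  have hM : 0 ≤ M := (abs_nonneg _).trans h0M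
  induction k with
  | zero => 
    refine ⟨by simpa using h0M, h1M.trans ?_⟩
    simp; linarith
  | succ k ih =>
    refine ⟨ih.2, ?_⟩
    have h0 : 0 < ((k:ℝ)+2) := by positivity
    have h := legQ_rec k x
    have hx1 : |x * legendreQ (k+1) x| ≤ M * 3^(k+1) := by
      rw [abs_mul]
      calc _ ≤ 1 * |legendreQ (k+1) x| := by gcongr
        _ ≤ _ := by rw [one_mul]; exact ih.2
    have h3 := ih.1
    rw [abs_le] at hx1 h3
    have hk : (0:ℝ) ≤ k := by positivity
    have h9 : (0:ℝ) ≤ M * 3^k := by positivity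
    have e1 : M * (3:ℝ)^(k+1) = 3 * (M * 3^k) := by ring
    have e2 : M * (3:ℝ)^(k+1+1) = 9 * (M * 3^k) := by ring
    rw [e1] at hx1
    rw [e2, abs_le]
    have h' : legendreQ (k+1+1) x = legendreQ (k+2) x := rfl
    rw [h']
    have hk9 : 0 ≤ (k:ℝ) * (M * 3^k) := by positivity
    constructor
    · refine le_of_mul_le_mul_left ?_ h0
      rw [h]
      nlinarith [mul_le_mul_of_nonneg_left hx1.1 (by positivity : 0 ≤ 2*(k:ℝ)+3),
        mul_le_mul_of_nonneg_left h3.2 (by positivity : 0 ≤ (k:ℝ)+1)]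
    · refine le_of_mul_le_mul_left ?_ h0
      rw [h]
      nlinarith [mul_le_mul_of_nonneg_left hx1.2 (by positivity : 0 ≤ 2*(k:ℝ)+3),
        mul_le_mul_of_nonneg_left h3.1 (by positivity : 0 ≤ (k:ℝ)+1)]

lemma legB_bound (j k : ℕ) : |legB j k| ≤ 2 * 3^k := by
  unfold legB
  have := intervalIntegral.norm_integral_le_of_norm_le_const (a := (-1:ℝ)) (b := 1)
    (C := 3^k) (f := fun x => x^j * legendreP k x) ?_
  · rw [Real.norm_eq_abs] at this
    refine this.trans (le_of_eq ?_)
    norm_num; ring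
  · intro x hx
    rw [Set.uIoc_of_le (by norm_num)] at hx
    have hx1 : |x| ≤ 1 := abs_le.2 ⟨hx.1.le, hx.2⟩
    rw [Real.norm_eq_abs, abs_mul, abs_pow]
    calc _ ≤ 1 * |legendreP k x| := by
          gcongr; exact pow_le_one₀ (abs_nonneg _) hx1
      _ ≤ _ := by rw [one_mul]; exact (legP_bound x hx1 k).1

/-- geometric sums -/
noncomputable def geo (t : ℝ) : ℕ → ℝ → ℝ
  | 0, _ => 0
  | (j+1), s => t * geo t j s + s^j

lemma geo_eq (t s : ℝ) (j : ℕ) : (s - t) * geo t j s = s^j - t^j := by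
  induction j with
  | zero => simp [geo]
  | succ j ih => rw [geo]; linear_combination t * ih

lemma geo_cont (t : ℝ) (j : ℕ) : Continuous (geo t j) := by
  induction j with
  | zero => 
    have : geo t 0 = fun _ => 0 := by funext s; rw [geo]
    rw [this]; fun_prop
  | succ j ih =>
    have : geo t (j+1) = fun s => t * geo t j s + s^j := by funext s; rw [geo]
    rw [this]; fun_prop

lemma geo_bound (t s : ℝ) (ht : |t| ≤ 1) (hs : |s| ≤ 1) (j : ℕ) : |geo t j s| ≤ 2^j := by
  have : |geo t j s| ≤ j := by
    induction j with
    | zero => simp [geo]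
    | succ j ih =>
      rw [geo]
      refine (abs_add_le _ _).trans ?_
      rw [abs_mul, abs_pow]
      push_cast
      have h1 : |t| * |geo t j s| ≤ 1 * j := by gcongr
      have h2 : |s|^j ≤ 1 := pow_le_one₀ (abs_nonneg _) hs
      linarith
  refine this.trans ?_
  exact_mod_cast (Nat.lt_two_pow_self (n := j)).le

noncomputable def geoR (t : ℝ) (j : ℕ) : ℝ :=
  t^j * legendreQ 0 t - (1/2) * ∫ s in (-1:ℝ)..1, geo t j s

lemma geoR_succ (t : ℝ) (j : ℕ) : geoR t (j+1) = t * geoR t j - (1/2) * legB j 0 := by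
  have : ∫ s in (-1:ℝ)..1, geo t (j+1) s = t * (∫ s in (-1:ℝ)..1, geo t j s) + legB j 0 := by
    unfold legB
    rw [← intervalIntegral.integral_const_mul, ← intervalIntegral.integral_add]
    · congr 1; funext s; simp only [geo, legendreP]; ring
    · exact ((geo_cont t j).const_mul t).intervalIntegrable _ _ 
    · exact Continuous.intervalIntegrable (by simp only [legendreP]; fun_prop) _ _
  unfold geoR
  rw [this]; ring

lemma christoffel (t : ℝ) (j N : ℕ) :
    ∑ k ∈ Finset.range (N+1), ((k:ℝ)+1/2) * legB (j+1) k * legendreQ k t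
    = t * (∑ k ∈ Finset.range (N+1), ((k:ℝ)+1/2) * legB j k * legendreQ k t)
      - (1/2) * legB j 0
      + (1/2) * ((N:ℝ)+1) * (legB j (N+1) * legendreQ N t - legB j N * legendreQ (N+1) t) := by
  induction N with
  | zero =>
    simp only [zero_add, Finset.sum_range_one, legB_zero]
    simp only [legendreQ]; push_cast; ring
  | succ N ih =>
    rw [Finset.sum_range_succ, ih, Finset.sum_range_succ (n := N+1)]
    have h1 := legB_succ j N
    have h2 := legQ_rec N t
    rw [show N+1+1 = N+2 from rfl]
    push_cast
    linear_combination (1/2) * legendreQ (N+1) t * h1 + (1/2) * legB j (N+1) * h2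

lemma leg_mono_sum (t : ℝ) (j N : ℕ) (h : j ≤ N) :
    ∑ k ∈ Finset.range (N+1), ((k:ℝ)+1/2) * legB j k * legendreQ k t = geoR t j := by
  induction j generalizing N with
  | zero =>
    rw [Finset.sum_eq_single 0]
    · have : legB 0 0 = 2 := by unfold legB; simp [legendreP]; norm_num
      rw [this]; simp [geoR, geo]
    · intro k _ hk
      rw [legB_vanish 0 k (by omega)]; ring
    · simp
  | succ j ih =>
    rw [christoffel, ih N (by omega), geoR_succ, legB_vanish j (N+1) (by omega),
      legB_vanish j N (by omega)]
    ring

lemma leg_hasSum (t : ℝ) (j : ℕ) :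
    HasSum (fun k : ℕ => ((k:ℝ)+1/2) * legB j k * legendreQ k t) (geoR t j) := by
  rw [← leg_mono_sum t j j le_rfl]
  apply hasSum_sum_of_ne_finset_zero
  intro k hk
  rw [legB_vanish j k (by simpa using hk)]; ring

lemma term_bound (t : ℝ) (ht : |t| ≤ 1) : ∃ M, 0 ≤ M ∧ ∀ j k : ℕ,
    |((k:ℝ)+1/2) * legB j k * legendreQ k t| ≤ M * (54^j * (1/2)^k) := by
  refine ⟨|legendreQ 0 t| + |legendreQ 1 t|, by positivity, fun j k => ?_⟩
  set M := |legendreQ 0 t| + |legendreQ 1 t| with hM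
  have hM0 : 0 ≤ M := by positivity
  have hQ := (legQ_bound t ht M (by rw [hM]; linarith [abs_nonneg (legendreQ 1 t)])
    (by rw [hM]; linarith [abs_nonneg (legendreQ 0 t)]) k).1
  by_cases hjk : j < k
  · rw [legB_vanish j k hjk]; simp; positivity
  · have hk3 : 2*(k:ℝ)+1 ≤ 3^k := by
      have := one_add_mul_le_pow (a := (2:ℝ)) (by norm_num) k
      norm_num at this; linarith
    rw [abs_mul, abs_mul, abs_of_nonneg (by positivity : 0 ≤ (k:ℝ)+1/2)]
    calc _ ≤ ((k:ℝ)+1/2) * (2*3^k) * (M * 3^k) := by gcongr; exact legB_bound j k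
      _ = (2*(k:ℝ)+1) * (M * 3^k * 3^k) := by ring
      _ ≤ 3^k * (M * 3^k * 3^k) := by gcongr
      _ = M * (54^k * (1/2)^k) := by
        rw [← mul_pow, show (54:ℝ) * (1/2) = 3*3*3 by norm_num, mul_pow, mul_pow]; ring
      _ ≤ _ := by
        gcongr
        · norm_num
        · omega

lemma general (f : ℝ → ℝ) (hf : Continuous f) (a : ℕ → ℝ) (C c : ℝ) (hC : 0 ≤ C) (hc : 0 ≤ c)
    (ha : ∀ j, |a j| ≤ C * (c^j / (j.factorial : ℝ)))
    (hs : ∀ x, HasSum (fun j => a j * x^j) (f x)) (t : ℝ) (ht : t ∈ Set.Ioo (-1:ℝ) 1) :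
    HasSum (fun k => legendreCoeff f k * legendreQ k t)
      (f t * legendreQ 0 t - (1/2) * ∫ s in (-1:ℝ)..1, (f s - f t) / (s - t)) := by
  have ht1 : |t| ≤ 1 := abs_le.2 ⟨ht.1.le, ht.2.le⟩
  have expS : ∀ r : ℝ, Summable fun j : ℕ => C * ((c * r)^j / (j.factorial : ℝ)) := fun r =>
    (Real.summable_pow_div_factorial (c * r)).mul_left C
  have hab : ∀ (j : ℕ) (r y : ℝ), |y| ≤ r^j →
      |a j * y| ≤ C * ((c * r)^j / (j.factorial : ℝ)) := by
    intro j r y hy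
    rw [abs_mul]
    calc _ ≤ C * (c^j / (j.factorial : ℝ)) * r^j :=
          mul_le_mul (ha j) hy (abs_nonneg _) (by positivity)
      _ = _ := by rw [mul_pow]; ring
  -- coefficients
  have hcoef : ∀ k : ℕ, HasSum (fun j => a j * (((k:ℝ)+1/2) * legB j k * legendreQ k t))
      (legendreCoeff f k * legendreQ k t) := by
    intro k
    have h1 : HasSum (fun j => ∫ x in (-1:ℝ)..1, a j * (x^j * legendreP k x))
        (∫ x in (-1:ℝ)..1, f x * legendreP k x) := by
      refine intervalIntegral.hasSum_integral_of_dominated_convergence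
        (fun j _ => C * ((c * 1)^j / (j.factorial : ℝ)) * 3^k) ?_ ?_ ?_ ?_ ?_
      · intro j
        have := legP_cont k
        exact Continuous.aestronglyMeasurable (by fun_prop)
      · intro j
        refine Filter.Eventually.of_forall fun x hx => ?_
        rw [Set.uIoc_of_le (by norm_num)] at hx
        have hx1 : |x| ≤ 1 := abs_le.2 ⟨hx.1.le, hx.2⟩
        rw [Real.norm_eq_abs, ← mul_assoc, abs_mul]
        refine mul_le_mul (hab j 1 _ ?_) (legP_bound x hx1 k).1 (abs_nonneg _) (by positivity)
        rw [abs_pow, one_pow]; exact pow_le_one₀ (abs_nonneg _) hx1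
      · exact Filter.Eventually.of_forall fun x _ => (expS 1).mul_right _
      · exact intervalIntegrable_const
      · refine Filter.Eventually.of_forall fun x _ => ?_
        simpa only [mul_assoc] using (hs x).mul_right (legendreP k x)
    have h2 := (h1.mul_left ((k:ℝ)+1/2)).mul_right (legendreQ k t)
    refine h2.congr_pt ?_ 
    intro j
    rw [intervalIntegral.integral_const_mul]; unfold legB; ring
  obtain ⟨M, hM, hMb⟩ := term_bound t ht1
  have hsum : Summable (fun p : ℕ × ℕ =>
      a p.1 * (((p.2:ℝ)+1/2) * legB p.1 p.2 * legendreQ p.2 t)) := by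
    have hg : Summable (fun p : ℕ × ℕ =>
        (C * ((c * 54)^p.1 / (p.1.factorial : ℝ))) * (M * (1/2:ℝ)^p.2)) := by
      apply Summable.mul_of_nonneg (expS 54) (summable_geometric_two.mul_left M)
      · intro j; positivity
      · intro k; positivity
    refine Summable.of_norm_bounded hg ?_
    rintro ⟨j, k⟩
    simp only [Real.norm_eq_abs]
    rw [abs_mul]
    calc _ ≤ C * (c^j / (j.factorial : ℝ)) * (M * (54^j * (1/2)^k)) :=
          mul_le_mul (ha j) (hMb j k) (abs_nonneg _) (by positivity)
      _ = _ := by rw [mul_pow]; ring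
  have hR : ∀ j, HasSum (fun k : ℕ => a j * (((k:ℝ)+1/2) * legB j k * legendreQ k t))
      (a j * geoR t j) := fun j => (leg_hasSum t j).mul_left _
  have hT := hsum.hasSum
  have hJ := hT.prod_fiberwise hR
  have hT' := (Equiv.prodComm ℕ ℕ).hasSum_iff.2 hT
  have hK := hT'.prod_fiberwise (g := fun k => legendreCoeff f k * legendreQ k t) hcoef
  have hgeo : HasSum (fun j => ∫ s in (-1:ℝ)..1, a j * geo t j s)
      (∫ s in (-1:ℝ)..1, (f s - f t) / (s - t)) := by
    refine intervalIntegral.hasSum_integral_of_dominated_convergence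
      (fun j _ => C * ((c * 2)^j / (j.factorial : ℝ))) ?_ ?_ ?_ ?_ ?_
    · intro j
      have := geo_cont t j
      exact Continuous.aestronglyMeasurable (by fun_prop)
    · intro j
      refine Filter.Eventually.of_forall fun x hx => ?_
      rw [Set.uIoc_of_le (by norm_num)] at hx
      have hx1 : |x| ≤ 1 := abs_le.2 ⟨hx.1.le, hx.2⟩
      exact hab j 2 _ (geo_bound t x ht1 hx1 j)
    · exact Filter.Eventually.of_forall fun x _ => expS 2
    · exact intervalIntegrable_const
    · have hne : ∀ᵐ s : ℝ, s ≠ t := by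
        simp [ae_iff]
      filter_upwards [hne] with s hst _
      have h0 : s - t ≠ 0 := sub_ne_zero.2 hst
      refine (((hs s).sub (hs t)).div_const (s - t)).congr_pt ?_
      intro j
      rw [eq_div_iff h0]
      linear_combination a j * geo_eq t s j
  have hfin : HasSum (fun j => a j * geoR t j)
      (f t * legendreQ 0 t - (1/2) * ∫ s in (-1:ℝ)..1, (f s - f t) / (s - t)) := by
    refine (((hs t).mul_right (legendreQ 0 t)).sub (hgeo.mul_left (1/2))).congr_pt ?_
    intro j
    rw [intervalIntegral.integral_const_mul]; unfold geoR; ring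
  rw [hfin.unique hJ]
  exact hK

lemma prolate_series (c : ℝ) (hc : 0 < c) (n : ℕ) (ψ : ℝ → ℝ) (lam : ℂ) (χ : ℝ)
    (h : ProlateDatum c n ψ lam χ) : ∃ (a : ℕ → ℝ) (C : ℝ), 0 ≤ C ∧
    (∀ j, |a j| ≤ C * (c^j / (j.factorial : ℝ))) ∧
    (∀ x, HasSum (fun j => a j * x^j) (ψ x)) := by
  have hcont : Continuous ψ := continuous_iff_continuousAt.2 fun x => (h.analytic x).continuousAt
  obtain ⟨K, hK⟩ := (isCompact_Icc (a := (-1:ℝ)) (b := 1)).exists_bound_of_continuousOn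
    hcont.continuousOn
  have hK0 : 0 ≤ K := (norm_nonneg _).trans (hK 0 (by simp))
  have hl : lam ≠ 0 := h.lam_ne_zero
  let m : ℕ → ℂ := fun j => ∫ t in (-1:ℝ)..1, (ψ t : ℂ) * (t:ℂ)^j
  have hm : ∀ j, ‖m j‖ ≤ K * 2 := by
    intro j
    have := intervalIntegral.norm_integral_le_of_norm_le_const (a := (-1:ℝ)) (b := 1)
      (C := K) (f := fun t : ℝ => (ψ t : ℂ) * (t:ℂ)^j) ?_
    · refine this.trans (le_of_eq ?_)
      norm_num
    · intro x hx
      rw [Set.uIoc_of_le (by norm_num)] at hx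
      have hx1 : |x| ≤ 1 := abs_le.2 ⟨hx.1.le, hx.2⟩
      rw [norm_mul, norm_pow, Complex.norm_real, Complex.norm_real]
      calc _ ≤ K * 1 := mul_le_mul (hK x ⟨hx.1.le, hx.2⟩)
            (pow_le_one₀ (norm_nonneg _) hx1) (by positivity) hK0
        _ = K := mul_one _
  have hseries : ∀ x : ℝ, HasSum
      (fun j : ℕ => ((Complex.I * c)^j / (j.factorial : ℂ) * m j / lam) * (x:ℂ)^j) (ψ x : ℂ) := by
    intro x
    have h1 : HasSum (fun j : ℕ => ∫ t in (-1:ℝ)..1,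
        ((Complex.I * c * x)^j / (j.factorial : ℂ)) * ((ψ t : ℂ) * (t:ℂ)^j))
        (∫ t in (-1:ℝ)..1, (ψ t : ℂ) * Complex.exp (Complex.I * (c:ℂ) * (x:ℂ) * (t:ℂ))) := by
      refine intervalIntegral.hasSum_integral_of_dominated_convergence
        (fun j _ => ((c * |x|)^j / (j.factorial : ℝ)) * K) ?_ ?_ ?_ ?_ ?_
      · intro j
        exact Continuous.aestronglyMeasurable (by fun_prop)
      · intro j
        refine Filter.Eventually.of_forall fun s hx => ?_
        rw [Set.uIoc_of_le (by norm_num)] at hx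
        have hx1 : |s| ≤ 1 := abs_le.2 ⟨hx.1.le, hx.2⟩
        rw [norm_mul, norm_mul, norm_div, norm_pow, norm_pow, norm_mul, norm_mul,
          Complex.norm_I, Complex.norm_real, Complex.norm_real, Complex.norm_real,
          Complex.norm_real, Complex.norm_natCast, one_mul, Real.norm_of_nonneg hc.le,
          Real.norm_eq_abs x]
        refine mul_le_mul_of_nonneg_left ?_ (by positivity)
        calc _ ≤ K * 1 := mul_le_mul (hK s ⟨hx.1.le, hx.2⟩)
              (pow_le_one₀ (norm_nonneg _) hx1) (by positivity) hK0
          _ = K := mul_one _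
      · exact Filter.Eventually.of_forall fun s _ =>
          (Real.summable_pow_div_factorial (c * |x|)).mul_right _
      · exact intervalIntegrable_const
      · refine Filter.Eventually.of_forall fun s _ => ?_
        have he := NormedSpace.expSeries_div_hasSum_exp (Complex.I * (c:ℂ) * (x:ℂ) * (s:ℂ))
        rw [← Complex.exp_eq_exp_ℂ] at he
        refine (he.mul_left (ψ s : ℂ)).congr_pt ?_
        intro j
        rw [mul_pow _ (s:ℂ)]; ring
    rw [← h.integral_eig x] at h1
    have h2 := h1.div_const lam
    rw [mul_div_cancel_left₀ _ hl] at h2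
    refine h2.congr_pt ?_
    intro j
    rw [intervalIntegral.integral_const_mul, mul_pow _ (x:ℂ)]
    ring
  refine ⟨fun j => ((Complex.I * c)^j / (j.factorial : ℂ) * m j / lam).re,
    K * 2 / ‖lam‖, by positivity, ?_, ?_⟩
  · intro j
    refine (Complex.abs_re_le_norm _).trans ?_
    rw [norm_div, norm_mul, norm_div, norm_pow, norm_mul, Complex.norm_I, Complex.norm_real,
      Complex.norm_natCast, one_mul, Real.norm_of_nonneg hc.le]
    calc _ ≤ c^j / (j.factorial : ℝ) * (K * 2) / ‖lam‖ := by gcongr; exact hm j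
      _ = _ := by ring
  · intro x
    have := Complex.hasSum_re (hseries x)
    rw [Complex.ofReal_re] at this
    refine this.congr_pt ?_
    intro j
    rw [← Complex.ofReal_pow, Complex.re_mul_ofReal]

theorem quad_weight_eq_tilde_phi
    (c : ℝ) (hc : 0 < c)
    (n : ℕ) (hn : 1 ≤ n)
    (ψn : ℝ → ℝ) (lamn : ℂ) (χn : ℝ)
    (hnd : ProlateDatum c n ψn lamn χn)
    (t : Fin n → ℝ) (ht_mono : StrictMono t)
    (ht_mem : ∀ j, t j ∈ Set.Ioo (-1:ℝ) 1)
    (ht_zero : ∀ j, ψn (t j) = 0) :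
    (∀ x ∈ Set.Ioo (-1:ℝ) 1, Summable (fun k => legendreCoeff ψn k * legendreQ k x)) ∧
    (∀ j : Fin n,
      quadWeight ψn (t j) =
        -2 * (∑' k : ℕ, legendreCoeff ψn k * legendreQ k (t j)) / deriv ψn (t j)) := by
  obtain ⟨a, C, hC, ha, hs⟩ := prolate_series c hc n ψn lamn χn hnd
  have hcont : Continuous ψn :=
    continuous_iff_continuousAt.2 fun x => (hnd.analytic x).continuousAt
  have hG := fun x hx => general ψn hcont a C c hC hc.le ha hs x hx
  refine ⟨fun x hx => (hG x hx).summable, fun j => ?_⟩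
  rw [(hG (t j) (ht_mem j)).tsum_eq, ht_zero j]
  unfold quadWeight
  simp only [sub_zero]
  ring
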